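/- The particle density n(t,x) = ∫_ℝ f(t,x,p) dp / (2π) is well defined for t ≥ 0 and satisfies the diffusion equation: for every t > 0 and every x ∈ ℝ, ∂n/∂t (t,x) = 𝔇 · ∂²n/∂x² (t,x). -/

import Mathlib

open MeasureTheory

/-- Relativistic energy `ε(p) = √(m² + p²)`. -/
noncomputable def eps (m p : ℝ) : ℝ := Real.sqrt (m ^ 2 + p ^ 2)

/-- The distribution function
`f(t,x,p) = exp(α − β ε(p)) + (1/2π) ∫ g(k) exp(−β ε(p) − i β 𝔇 k p + i k x − 𝔇 k² t) dk`. -/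
noncomputable def fdist (m β D α : ℝ) (g : ℝ → ℂ) (t x p : ℝ) : ℂ :=
  Complex.exp (↑(α - β * eps m p)) +
    (2 * Real.pi)⁻¹ * ∫ k : ℝ, g k * Complex.exp (-(↑(β * eps m p))
      - Complex.I * ↑(β * D * k * p) + Complex.I * ↑(k * x) - ↑(D * k ^ 2 * t))

/-- The particle density `n(t,x) = ∫ f(t,x,p) dp / (2π)`. -/
noncomputable def ndens (m β D α : ℝ) (g : ℝ → ℂ) (t x : ℝ) : ℂ :=
  (2 * Real.pi)⁻¹ * ∫ p : ℝ, fdist m β D α g t x p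


lemma cont_eps (m : ℝ) : Continuous (eps m) := by
  unfold eps; fun_prop

lemma int_exp_eps (m β : ℝ) (hβ : 0 < β) :
    Integrable (fun p : ℝ => Real.exp (-(β * eps m p))) := by
  have hc := cont_eps m
  have hle : ∀ p, |p| ≤ eps m p := fun p => by
    unfold eps
    exact Real.abs_le_sqrt (by nlinarith [sq_nonneg m])
  have h1 : IntegrableOn (fun p : ℝ => Real.exp (-(β * eps m p))) (Set.Iic 0) := by
    refine (integrableOn_exp_mul_Iic hβ 0).mono' (by fun_prop) (Filter.Eventually.of_forall ?_)
    intro p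
    rw [Real.norm_eq_abs, Real.abs_exp, Real.exp_le_exp]
    nlinarith [hle p, neg_abs_le p]
  have h2 : IntegrableOn (fun p : ℝ => Real.exp (-(β * eps m p))) (Set.Ioi 0) := by
    refine (integrableOn_exp_mul_Ioi (neg_lt_zero.2 hβ) 0).mono' (by fun_prop)
      (Filter.Eventually.of_forall ?_)
    intro p
    rw [Real.norm_eq_abs, Real.abs_exp, Real.exp_le_exp]
    nlinarith [hle p, le_abs_self p]
  have := h1.union h2
  rwa [Set.Iic_union_Ioi, integrableOn_univ] at this

/-- the kernel in `p` and `k`. -/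
noncomputable def kerPK (m β D p k : ℝ) : ℂ :=
  Complex.exp (-(↑(β * eps m p)) - Complex.I * ↑(β * D * k * p))

lemma norm_kerPK (m β D p k : ℝ) : ‖kerPK m β D p k‖ = Real.exp (-(β * eps m p)) := by
  unfold kerPK
  rw [Complex.norm_exp]
  congr 1
  simp only [Complex.sub_re, Complex.neg_re, Complex.ofReal_re, Complex.re_mul_ofReal, Complex.I_re]
  ring

lemma prodInt (m β D : ℝ) (hβ : 0 < β) (φ : ℝ → ℂ) (hφ : Integrable φ) :
    Integrable (fun z : ℝ × ℝ => φ z.2 * kerPK m β D z.1 z.2) (volume.prod volume) := by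
  have hc := cont_eps m
  have h := (int_exp_eps m β hβ).mul_prod hφ.norm
  refine h.mono' ?_ (Filter.Eventually.of_forall ?_)
  · refine hφ.aestronglyMeasurable.comp_snd.mul (Continuous.aestronglyMeasurable ?_)
    unfold kerPK
    fun_prop
  · rintro ⟨p, k⟩
    rw [norm_mul, norm_kerPK, mul_comm]

/-- the momentum-integrated kernel. -/
noncomputable def kerK (m β D k : ℝ) : ℂ := ∫ p : ℝ, kerPK m β D p k

lemma int_kerK (m β D : ℝ) (hβ : 0 < β) (φ : ℝ → ℂ) (hφ : Integrable φ) :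
    Integrable (fun k => φ k * kerK m β D k) := by
  have := (prodInt m β D hβ φ hφ).integral_prod_right
  refine this.congr (Filter.Eventually.of_forall fun k => ?_)
  simp only [kerK, integral_const_mul]

lemma norm_osc (D t k x : ℝ) :
    ‖Complex.exp (Complex.I * ↑(k * x) - ↑(D * k ^ 2 * t))‖ = Real.exp (-(D * k ^ 2 * t)) := by
  rw [Complex.norm_exp]
  congr 1
  simp only [Complex.sub_re, Complex.ofReal_re, Complex.re_mul_ofReal, Complex.I_re]
  ring

lemma norm_osc_le (D t k x : ℝ) (hD : 0 < D) (ht : 0 ≤ t) :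
    ‖Complex.exp (Complex.I * ↑(k * x) - ↑(D * k ^ 2 * t))‖ ≤ 1 := by
  rw [norm_osc, Real.exp_le_one_iff]
  have : 0 ≤ D * k ^ 2 * t := by positivity
  linarith

lemma int_osc (D t x : ℝ) (hD : 0 < D) (ht : 0 ≤ t) (φ : ℝ → ℂ) (hφ : Integrable φ) :
    Integrable (fun k : ℝ => φ k * Complex.exp (Complex.I * ↑(k * x) - ↑(D * k ^ 2 * t))) := by
  refine hφ.mul_bdd (c := 1) (Continuous.aestronglyMeasurable (by fun_prop))
    (Filter.Eventually.of_forall fun k => norm_osc_le D t k x hD ht)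

lemma fdist_eq (m β D α : ℝ) (g : ℝ → ℂ) (t x p : ℝ) :
    fdist m β D α g t x p = Complex.exp (↑(α - β * eps m p)) +
      (2 * Real.pi)⁻¹ * ∫ k : ℝ,
        (g k * Complex.exp (Complex.I * ↑(k * x) - ↑(D * k ^ 2 * t))) * kerPK m β D p k := by
  unfold fdist kerPK
  congr 2
  refine integral_congr_ae (Filter.Eventually.of_forall fun k => ?_)
  simp only
  rw [mul_assoc (g k), ← Complex.exp_add]
  congr 2
  ring

lemma int_first (m β α : ℝ) (hβ : 0 < β) :
    Integrable (fun p : ℝ => Complex.exp (↑(α - β * eps m p))) := by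
  have h := ((int_exp_eps m β hβ).const_mul (Real.exp α)).ofReal (𝕜 := ℂ)
  refine h.congr (Filter.Eventually.of_forall fun p => ?_)
  simp only [← Real.exp_add, ← sub_eq_add_neg]
  exact Complex.ofReal_exp _

lemma int_second (m β D t x : ℝ) (hβ : 0 < β) (hD : 0 < D) (ht : 0 ≤ t)
    (g : ℝ → ℂ) (hg : Integrable g) :
    Integrable (fun p : ℝ => ∫ k : ℝ,
        (g k * Complex.exp (Complex.I * ↑(k * x) - ↑(D * k ^ 2 * t))) * kerPK m β D p k) :=
  (prodInt m β D hβ _ (int_osc D t x hD ht g hg)).integral_prod_left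

lemma ndens_eq (m β D α t x : ℝ) (hβ : 0 < β) (hD : 0 < D) (ht : 0 ≤ t)
    (g : ℝ → ℂ) (hg : Integrable g) :
    ndens m β D α g t x = (2 * Real.pi)⁻¹ * (∫ p : ℝ, Complex.exp (↑(α - β * eps m p))) +
      (2 * Real.pi)⁻¹ * (2 * Real.pi)⁻¹ * ∫ k : ℝ, (g k * kerK m β D k) *
        Complex.exp (Complex.I * ↑(k * x) - ↑(D * k ^ 2 * t)) := by
  unfold ndens
  simp only [fdist_eq]
  rw [integral_add (int_first m β α hβ) ((int_second m β D t x hβ hD ht g hg).const_mul _),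
    integral_const_mul, mul_add, ← mul_assoc,
    integral_integral_swap (prodInt m β D hβ _ (int_osc D t x hD ht g hg))]
  congr 2
  refine integral_congr_ae (Filter.Eventually.of_forall fun k => ?_)
  simp only [integral_const_mul, kerK]
  ring

lemma deriv_x (D t : ℝ) (hD : 0 < D) (ht : 0 ≤ t) (h : ℝ → ℂ) (h0 : Integrable h)
    (h1 : Integrable (fun k : ℝ => (k : ℂ) * h k)) (x : ℝ) :
    HasDerivAt (fun y : ℝ => ∫ k : ℝ, h k *
        Complex.exp (Complex.I * ↑(k * y) - ↑(D * k ^ 2 * t)))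
      (∫ k : ℝ, (Complex.I * (k * h k)) *
        Complex.exp (Complex.I * ↑(k * x) - ↑(D * k ^ 2 * t))) x := by
  refine (hasDerivAt_integral_of_dominated_loc_of_deriv_le (s := Set.univ)
    (F := fun (y k : ℝ) => h k * Complex.exp (Complex.I * ↑(k * y) - ↑(D * k ^ 2 * t)))
    (F' := fun (y k : ℝ) => (Complex.I * (k * h k)) *
        Complex.exp (Complex.I * ↑(k * y) - ↑(D * k ^ 2 * t)))
    (bound := fun k : ℝ => ‖(k : ℂ) * h k‖)
    Filter.univ_mem (Filter.Eventually.of_forall fun y =>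
      (int_osc D t y hD ht h h0).aestronglyMeasurable)
    (int_osc D t x hD ht h h0)
    (int_osc D t x hD ht _ (h1.const_mul Complex.I)).aestronglyMeasurable
    (Filter.Eventually.of_forall fun k y _ => ?_) h1.norm
    (Filter.Eventually.of_forall fun k y _ => ?_)).2
  · rw [norm_mul, norm_mul Complex.I, Complex.norm_I, one_mul]
    exact mul_le_of_le_one_right (norm_nonneg _) (norm_osc_le D t k y hD ht)
  · have e : HasDerivAt (fun y : ℝ => Complex.I * ((k * y : ℝ) : ℂ) - ↑(D * k ^ 2 * t))
        (Complex.I * ((k * 1 : ℝ) : ℂ)) y :=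
      ((((hasDerivAt_id y).const_mul k).ofReal_comp).const_mul Complex.I).sub_const _
    refine (e.cexp.const_mul (h k)).congr_deriv ?_
    push_cast
    ring

lemma deriv_t (D t : ℝ) (hD : 0 < D) (ht : 0 < t) (h : ℝ → ℂ) (h0 : Integrable h)
    (h2 : Integrable (fun k : ℝ => (k : ℂ) * (k * h k))) (x : ℝ) :
    HasDerivAt (fun s : ℝ => ∫ k : ℝ, h k *
        Complex.exp (Complex.I * ↑(k * x) - ↑(D * k ^ 2 * s)))
      (∫ k : ℝ, (-(D : ℂ) * (k * (k * h k))) *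
        Complex.exp (Complex.I * ↑(k * x) - ↑(D * k ^ 2 * t))) t := by
  refine (hasDerivAt_integral_of_dominated_loc_of_deriv_le (s := Set.Ioi 0)
    (F := fun (s k : ℝ) => h k * Complex.exp (Complex.I * ↑(k * x) - ↑(D * k ^ 2 * s)))
    (F' := fun (s k : ℝ) => (-(D : ℂ) * (k * (k * h k))) *
        Complex.exp (Complex.I * ↑(k * x) - ↑(D * k ^ 2 * s)))
    (bound := fun k : ℝ => ‖-(D : ℂ) * (k * (k * h k))‖)
    (Ioi_mem_nhds ht) (Filter.eventually_of_mem (Ioi_mem_nhds ht) fun s hs =>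
      (int_osc D s x hD (le_of_lt hs) h h0).aestronglyMeasurable)
    (int_osc D t x hD ht.le h h0)
    (int_osc D t x hD ht.le _ (h2.const_mul _)).aestronglyMeasurable
    (Filter.Eventually.of_forall fun k s hs => ?_) (h2.const_mul _).norm
    (Filter.Eventually.of_forall fun k s hs => ?_)).2
  · rw [norm_mul]
    exact mul_le_of_le_one_right (norm_nonneg _) (norm_osc_le D s k x hD (le_of_lt hs))
  · have e : HasDerivAt (fun s : ℝ => Complex.I * ((k * x : ℝ) : ℂ) - ((D * k ^ 2 * s : ℝ) : ℂ))
        (-((D * k ^ 2 * 1 : ℝ) : ℂ)) s :=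
      (((hasDerivAt_id s).const_mul (D * k ^ 2)).ofReal_comp).const_sub _
    refine (e.cexp.const_mul (h k)).congr_deriv ?_
    push_cast
    ring

/-- the particle density `n(t,x) = ∫ f(t,x,p) dp/(2π)` is well defined for
`t ≥ 0` (the momentum integral converges) and satisfies the diffusion equation
`∂_t n = 𝔇 ∂_x² n` for every `t > 0` and every `x ∈ ℝ`. -/
theorem ndens_diffusion (m β D α : ℝ) (hm : 0 < m) (hβ : 0 < β) (hD : 0 < D)
    (g : SchwartzMap ℝ ℂ) (hg : ∀ k : ℝ, g (-k) = (starRingEnd ℂ) (g k)) :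
    (∀ t : ℝ, 0 ≤ t → ∀ x : ℝ,
      Integrable (fun p : ℝ => fdist m β D α (⇑g) t x p)) ∧
    (∀ t : ℝ, 0 < t → ∀ x : ℝ,
      deriv (fun s : ℝ => ndens m β D α (⇑g) s x) t
        = ↑D * deriv (deriv (fun y : ℝ => ndens m β D α (⇑g) t y)) x) := by
  have hgi : Integrable (⇑g) := g.integrable
  have hg1 : Integrable (fun k : ℝ => (k : ℂ) * g k) := by
    refine (g.integrable_pow_mul volume 1).mono' (Continuous.aestronglyMeasurable (by fun_prop))
      (Filter.Eventually.of_forall fun k => ?_)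
    simp
  have hg2 : Integrable (fun k : ℝ => (k : ℂ) * ((k : ℂ) * g k)) := by
    refine (g.integrable_pow_mul volume 2).mono' (Continuous.aestronglyMeasurable (by fun_prop))
      (Filter.Eventually.of_forall fun k => ?_)
    simp only [norm_mul, Complex.norm_real]
    exact le_of_eq (by ring)
  have H0 := int_kerK m β D hβ _ hgi
  have H1 : Integrable (fun k : ℝ => (k : ℂ) * (g k * kerK m β D k)) :=
    (int_kerK m β D hβ _ hg1).congr (Filter.Eventually.of_forall fun k => by simp only; ring)
  have H2 : Integrable (fun k : ℝ => (k : ℂ) * ((k : ℂ) * (g k * kerK m β D k))) :=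
    (int_kerK m β D hβ _ hg2).congr (Filter.Eventually.of_forall fun k => by simp only; ring)
  refine ⟨fun t ht x => ?_, fun t ht x => ?_⟩
  · simp only [fdist_eq]
    exact (int_first m β α hβ).add ((int_second m β D t x hβ hD ht g hgi).const_mul _)
  · have hx1 : deriv (fun y : ℝ => ndens m β D α (⇑g) t y) = fun y : ℝ =>
        ((2 * Real.pi)⁻¹ * (2 * Real.pi)⁻¹ : ℂ) *
          ∫ k : ℝ, (Complex.I * (k * (g k * kerK m β D k))) *
            Complex.exp (Complex.I * ↑(k * y) - ↑(D * k ^ 2 * t)) := by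
      funext y
      simp only [ndens_eq m β D α t _ hβ hD ht.le g hgi]
      exact (((deriv_x D t hD ht.le _ H0 H1 y).const_mul _).const_add _).deriv
    have H2' : Integrable (fun k : ℝ => (k : ℂ) * (Complex.I * (k * (g k * kerK m β D k)))) :=
      (H2.const_mul Complex.I).congr (Filter.Eventually.of_forall fun k => by simp only; ring)
    rw [hx1, ((deriv_x D t hD ht.le _ (H1.const_mul Complex.I) H2' x).const_mul _).deriv]
    have hd := (((deriv_t D t hD ht _ H0 H2 x).const_mul
      ((2 * Real.pi)⁻¹ * (2 * Real.pi)⁻¹ : ℂ)).const_add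
      ((2 * Real.pi)⁻¹ * (∫ p : ℝ, Complex.exp (↑(α - β * eps m p))) : ℂ)).congr_of_eventuallyEq
      (Filter.eventually_of_mem (Ioi_mem_nhds ht) fun s hs =>
        ndens_eq m β D α s x hβ hD (le_of_lt hs) g hgi)
    rw [hd.deriv,
      mul_left_comm (D : ℂ), ← integral_const_mul (D : ℂ)]
    congr 1
    refine integral_congr_ae (Filter.Eventually.of_forall fun k => ?_)
    simp only
    linear_combination (-(D : ℂ) * k * k * g k * kerK m β D k *
      Complex.exp (Complex.I * ↑(k * x) - ↑(D * k ^ 2 * t))) * Complex.I_sq
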